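/- (Progress without quorums via client restriction.) Suppose every quorum-intersecting register set r has any two quorums in 𝒬 r intersecting, and let σ₀, …, σ_N be an execution in which every write-once step that writes a non-nil value satisfies both Rule 3 and Rule 4 at its pre-state. Suppose register set r is client-restricted and σ_N s₀ r = some (some v) for some server s₀. Then every value decided at σ_N in any register set r'' ≤ r equals v. -/

import Mathlib

/-- `Step σ σ' s r x`: a write-once step from `σ` to `σ'` writing `x` to the
previously unwritten register `r` on server `s`, leaving all else unchanged. -/
def Step {S V : Type*} (σ σ' : S → ℕ → Option (Option V))
    (s : S) (r : ℕ) (x : Option V) : Prop :=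
  σ s r = none ∧ σ' s r = some x ∧
    ∀ (s' : S) (r' : ℕ), ¬(s' = s ∧ r' = r) → σ' s' r' = σ s' r'

/-- `Possible CR σ r Q v`: the value `v` is a possible decision of the quorum
`Q` in register set `r` at state `σ`: every `s ∈ Q` has register `r` unwritten
or containing `v`, and moreover, if `r` is client-restricted (`CR r`), every
server with a non-nil value in register set `r` holds `v` there. -/
def Possible {S V : Type*} (CR : ℕ → Prop)
    (σ : S → ℕ → Option (Option V)) (r : ℕ) (Q : Set S) (v : V) : Prop :=
  (∀ s ∈ Q, σ s r = none ∨ σ s r = some (some v)) ∧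
  (CR r → ∀ (s : S) (w : V), σ s r = some (some w) → w = v)

/-- `Rule4 𝒬 CR σ r v`: a step writing the non-nil value `v` to register set
`r` satisfies Rule 4 at its pre-state `σ`: for every earlier register set
`r' < r`, every quorum `Q ∈ 𝒬 r'` and every value `v' ≠ v`, `v'` is not a
possible decision of `Q` in register set `r'` at `σ`. -/
def Rule4 {S V : Type*} (𝒬 : ℕ → Set (Set S)) (CR : ℕ → Prop)
    (σ : S → ℕ → Option (Option V)) (r : ℕ) (v : V) : Prop :=
  ∀ r' < r, ∀ Q ∈ 𝒬 r', ∀ v' : V, v' ≠ v → ¬ Possible CR σ r' Q v'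

/-- `Decided 𝒬 σ r v`: the value `v` is decided in register set `r` at state
`σ`, i.e. some quorum `Q ∈ 𝒬 r` has `σ s r = some (some v)` for all `s ∈ Q`. -/
def Decided {S V : Type*} (𝒬 : ℕ → Set (Set S))
    (σ : S → ℕ → Option (Option V)) (r : ℕ) (v : V) : Prop :=
  ∃ Q ∈ 𝒬 r, ∀ s ∈ Q, σ s r = some (some v)

/-- Registers are write-once: a step preserves the contents of written registers. -/
theorem Step.eq_some {S V : Type*} {σ σ' : S → ℕ → Option (Option V)}
    {s : S} {r : ℕ} {x : Option V} (h : Step σ σ' s r x)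
    {t : S} {i : ℕ} {y : Option V} (hy : σ t i = some y) : σ' t i = some y := by
  rw [h.2.2 t i, hy]
  rintro ⟨rfl, rfl⟩
  simp [h.1] at hy

/-- Along an execution, written registers keep their contents. -/
theorem eq_some_of_le {S V : Type*} {N : ℕ} {σ : ℕ → S → ℕ → Option (Option V)}
    (hstep : ∀ k < N, ∃ (s : S) (r : ℕ) (x : Option V), Step (σ k) (σ (k + 1)) s r x)
    {k m : ℕ} (hkm : k ≤ m) (hm : m ≤ N) {t : S} {i : ℕ} {y : Option V}
    (hy : σ k t i = some y) : σ m t i = some y := by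
  induction m, hkm using Nat.le_induction with
  | base => exact hy
  | succ m _ ih =>
    obtain ⟨s, r, x, h⟩ := hstep m hm
    exact h.eq_some (ih (by lia))

/-- A register that is written at some point of an execution was written by a step. -/
theorem exists_step_of_eq_some {S V : Type*} {N : ℕ} {σ : ℕ → S → ℕ → Option (Option V)}
    (h0 : ∀ (s : S) (r : ℕ), σ 0 s r = none)
    (hstep : ∀ k < N, ∃ (s : S) (r : ℕ) (x : Option V), Step (σ k) (σ (k + 1)) s r x)
    {m : ℕ} (hm : m ≤ N) {t : S} {i : ℕ} {y : Option V} (hy : σ m t i = some y) :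
    ∃ k < m, Step (σ k) (σ (k + 1)) t i y := by
  induction m with
  | zero => simp [h0] at hy
  | succ m ih =>
    obtain ⟨s, r, x, h⟩ := hstep m hm
    by_cases hsr : t = s ∧ i = r
    · obtain ⟨rfl, rfl⟩ := hsr
      obtain rfl : x = y := Option.some.inj (h.2.1.symm.trans hy)
      exact ⟨m, m.lt_succ_self, h⟩
    · obtain ⟨k, hk, hk'⟩ := ih (by lia) ((h.2.2 t i hsr).symm.trans hy)
      exact ⟨k, by lia, hk'⟩

/-- Under Rule 3, all non-nil values in a client-restricted register set agree. -/
theorem value_unique_of_clientRestricted {S V : Type*} {CR : ℕ → Prop} {N : ℕ}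
    {σ : ℕ → S → ℕ → Option (Option V)}
    (h0 : ∀ (s : S) (r : ℕ), σ 0 s r = none)
    (hstep : ∀ k < N, ∃ (s : S) (r : ℕ) (x : Option V), Step (σ k) (σ (k + 1)) s r x)
    (hrule3 : ∀ k < N, ∀ (s : S) (i : ℕ) (w : V),
      Step (σ k) (σ (k + 1)) s i (some w) → CR i →
      ∀ (s' : S) (w' : V), σ k s' i = some (some w') → w' = w)
    {i : ℕ} (hi : CR i) {m : ℕ} (hm : m ≤ N) {s t : S} {a b : V}
    (ha : σ m s i = some (some a)) (hb : σ m t i = some (some b)) : a = b := by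
  induction m with
  | zero => simp [h0] at ha
  | succ m ih =>
    obtain ⟨u, r, x, h⟩ := hstep m hm
    by_cases hs : s = u ∧ i = r <;> by_cases ht : t = u ∧ i = r
    · obtain ⟨rfl, rfl⟩ := hs
      obtain ⟨rfl, -⟩ := ht
      simpa using ha.symm.trans hb
    · obtain ⟨rfl, rfl⟩ := hs
      obtain rfl : x = some a := Option.some.inj (h.2.1.symm.trans ha)
      exact (hrule3 m hm s i a h hi t b ((h.2.2 t i ht).symm.trans hb)).symm
    · obtain ⟨rfl, rfl⟩ := ht
      obtain rfl : x = some b := Option.some.inj (h.2.1.symm.trans hb)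
      exact hrule3 m hm t i b h hi s a ((h.2.2 s i hs).symm.trans ha)
    · exact ih (by lia) ((h.2.2 s i hs).symm.trans ha) ((h.2.2 t i ht).symm.trans hb)

/-- **Progress without quorums via client restriction.**
Each register set is designated either quorum-intersecting (`¬ CR r`) or
client-restricted (`CR r`), quorums are non-empty, and every quorum-intersecting
register set has any two of its quorums intersecting. Let `σ 0, …, σ N` be an
execution in which every write-once step writing a non-nil value `w` to a
register set `i` satisfies Rule 3 (if `i` is client-restricted, every non-nil
value in register set `i` at the pre-state equals `w`) and Rule 4 at its
pre-state. If the register set `r` is client-restricted, and some server `s₀`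
holds the value `v` in register `r` at `σ N`, then every value decided at `σ N`
in any register set `r'' ≤ r` equals `v`. -/
theorem progress_without_quorums_client_restricted
    {S V : Type*} [Fintype S]
    (𝒬 : ℕ → Set (Set S)) (CR : ℕ → Prop)
    (hQI : ∀ r : ℕ, ¬ CR r → ∀ Q ∈ 𝒬 r, ∀ Q' ∈ 𝒬 r, (Q ∩ Q').Nonempty)
    (hQne : ∀ r : ℕ, ∀ Q ∈ 𝒬 r, Q.Nonempty)
    (N : ℕ) (σ : ℕ → S → ℕ → Option (Option V))
    (h0 : ∀ (s : S) (r : ℕ), σ 0 s r = none)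
    (hstep : ∀ k < N, ∃ (s : S) (r : ℕ) (x : Option V), Step (σ k) (σ (k + 1)) s r x)
    (hrule3 : ∀ k < N, ∀ (s : S) (i : ℕ) (w : V),
      Step (σ k) (σ (k + 1)) s i (some w) → CR i →
      ∀ (s' : S) (w' : V), σ k s' i = some (some w') → w' = w)
    (hrule4 : ∀ k < N, ∀ (s : S) (i : ℕ) (w : V),
      Step (σ k) (σ (k + 1)) s i (some w) → Rule4 𝒬 CR (σ k) i w)
    (r : ℕ) (hr : CR r) (s₀ : S) (v : V)
    (hval : σ N s₀ r = some (some v))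
    (r'' : ℕ) (hr'' : r'' ≤ r) (v'' : V)
    (hdec : Decided 𝒬 (σ N) r'' v'') :
    v'' = v := by
  obtain ⟨Q, hQ, hQv⟩ := hdec
  obtain ⟨q, hq⟩ := hQne r'' Q hQ
  rcases hr''.eq_or_lt with rfl | hlt
  · exact value_unique_of_clientRestricted h0 hstep hrule3 hr le_rfl (hQv q hq) hval
  obtain ⟨k, hk, hwrite⟩ := exists_step_of_eq_some h0 hstep le_rfl hval
  by_contra hne
  refine hrule4 k hk s₀ r v hwrite r'' hlt Q hQ v'' hne ⟨fun s hs => ?_, fun hCR s w hw => ?_⟩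
  · cases hy : σ k s r'' with
    | none => exact Or.inl rfl
    | some y =>
      exact Or.inr ((eq_some_of_le hstep hk.le le_rfl hy).symm.trans (hQv s hs))
  · exact value_unique_of_clientRestricted h0 hstep hrule3 hCR le_rfl
      (eq_some_of_le hstep hk.le le_rfl hw) (hQv q hq)
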